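/- If $A = \{a_1, \ldots, a_k\}$ is a set of $k$ relatively prime positive integers, then $p_A(n) \sim \frac{n^{k-1}}{(k-1)!\,a_1 a_2 \cdots a_k}$ as $n \to \infty$. -/

import Mathlib

open Filter

/-- `f` is a representation of `n` with parts in `A` and multiplicities in `M`:
`n = ∑ a ∈ A, m_a * a` with each nonzero multiplicity lying in `M`. -/
def IsRepr (A M : Set ℕ) (n : ℕ) (f : ℕ →₀ ℕ) : Prop :=
  (∀ a ∈ f.support, a ∈ A) ∧ (∀ a ∈ f.support, f a ∈ M) ∧ f.sum (fun a m => m * a) = n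

/-- number of partitions of `n` with parts in `A` and multiplicities in `M` -/
noncomputable def pAM (A M : Set ℕ) (n : ℕ) : ℕ :=
  Nat.card {f : ℕ →₀ ℕ // IsRepr A M n f}

/-- number of partitions of `n` with parts in `A` (unrestricted multiplicities) -/
noncomputable def pA (A : Set ℕ) (n : ℕ) : ℕ :=
  pAM A {m | 0 < m} n

/-- counting function of a set of positive integers -/
noncomputable def cnt (S : Set ℕ) (x : ℝ) : ℕ :=
  Nat.card {a : ℕ // a ∈ S ∧ (a : ℝ) ≤ x}

/-! ### Counting representations -/

theorem setOf_isRepr_finite (A : Finset ℕ) (hpos : ∀ a ∈ A, 0 < a) (n : ℕ) :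
    {f | IsRepr ↑A {m | 0 < m} n f}.Finite := by
  refine (Set.finite_Iic (∑ a ∈ A, Finsupp.single a n)).subset ?_
  rintro f ⟨hA, -, hsum⟩ a
  by_cases ha : a ∈ f.support
  · have haA : a ∈ A := hA a ha
    have h1 : f a * a ≤ n := by
      rw [← hsum]
      exact Finset.single_le_sum (f := fun a => f a * a) (fun _ _ => Nat.zero_le _) ha
    have h2 : f a ≤ n := (Nat.le_mul_of_pos_right _ (hpos a haA)).trans h1
    rw [Finsupp.finsetSum_apply]
    refine le_trans ?_ (Finset.single_le_sum (f := fun i => Finsupp.single i n a)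
      (fun _ _ => Nat.zero_le _) haA)
    simpa using h2
  · rw [Finsupp.notMem_support_iff.mp ha]
    exact Nat.zero_le _

theorem pA_eq_ncard (A : Set ℕ) (n : ℕ) : pA A n = {f | IsRepr A {m | 0 < m} n f}.ncard := rfl

theorem isRepr_add_single {A : Set ℕ} {b n : ℕ} (hb : b ∈ A) {f : ℕ →₀ ℕ} :
    IsRepr A {m | 0 < m} (n + b) (f + Finsupp.single b 1) ↔ IsRepr A {m | 0 < m} n f := by
  have hsum : (f + Finsupp.single b 1).sum (fun a m => m * a) = f.sum (fun a m => m * a) + b := by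
    rw [Finsupp.sum_add_index' (by simp) (by intros; ring)]
    simp
  unfold IsRepr
  rw [hsum]
  simp only [Set.mem_ofPred_eq, add_left_inj, Finsupp.mem_support_iff, Finsupp.add_apply]
  constructor
  · rintro ⟨h1, -, h3⟩
    exact ⟨fun a ha => h1 a (by omega), fun a ha => by omega, h3⟩
  · rintro ⟨h1, -, h3⟩
    refine ⟨fun a ha => ?_, fun a ha => by omega, h3⟩
    by_cases hab : a = b
    · exact hab ▸ hb
    · exact h1 a (by simpa [Finsupp.single_apply, Ne.symm hab] using ha)

theorem pA_empty (n : ℕ) : pA ∅ n = if n = 0 then 1 else 0 := by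
  have h : {f | IsRepr ∅ {m | 0 < m} n f} = if n = 0 then {0} else ∅ := by
    ext f
    split_ifs with hn
    · subst hn
      simp only [Set.mem_ofPred_eq, Set.mem_singleton_iff]
      constructor
      · rintro ⟨h, -, -⟩
        ext a
        by_contra ha
        exact h a (Finsupp.mem_support_iff.mpr ha)
      · rintro rfl
        simp [IsRepr]
    · simp only [Set.mem_ofPred_eq, Set.mem_empty_iff_false, iff_false]
      rintro ⟨h, -, h'⟩
      have : f = 0 := by
        ext a
        by_contra ha
        exact h a (Finsupp.mem_support_iff.mpr ha)
      subst this
      exact hn (by simpa using h'.symm)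
  rw [pA_eq_ncard, h]
  split_ifs <;> simp

theorem isRepr_iff_of_apply_eq_zero {A : Finset ℕ} {b n : ℕ} (hb : b ∉ A) {f : ℕ →₀ ℕ} :
    IsRepr ↑A {m | 0 < m} n f ↔ IsRepr ↑(insert b A) {m | 0 < m} n f ∧ f b = 0 := by
  unfold IsRepr
  constructor
  · rintro ⟨h1, h2, h3⟩
    refine ⟨⟨fun a ha => by simpa using Or.inr (h1 a ha), h2, h3⟩, ?_⟩
    by_contra h
    exact hb (h1 b (Finsupp.mem_support_iff.mpr h))
  · rintro ⟨⟨h1, h2, h3⟩, h4⟩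
    refine ⟨fun a ha => ?_, h2, h3⟩
    have := h1 a ha
    simp only [Finset.coe_insert, Set.mem_insert_iff] at this
    rcases this with rfl | h
    · exact absurd h4 (Finsupp.mem_support_iff.mp ha)
    · exact h

theorem pA_insert_of_lt {A : Finset ℕ} {b n : ℕ} (hb : b ∉ A) (hn : n < b) :
    pA ↑(insert b A) n = pA ↑A n := by
  rw [pA_eq_ncard, pA_eq_ncard]
  congr 1
  ext f
  simp only [Set.mem_ofPred_eq]
  rw [isRepr_iff_of_apply_eq_zero hb, iff_self_and]
  rintro ⟨-, -, h⟩
  by_contra hf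
  have h1 : f b * b ≤ n := by
    rw [← h]
    exact Finset.single_le_sum (f := fun a => f a * a) (fun _ _ => Nat.zero_le _)
      (Finsupp.mem_support_iff.mpr hf)
  have := Nat.le_mul_of_pos_left b (Nat.pos_of_ne_zero hf)
  omega

theorem pA_insert_add {A : Finset ℕ} {b : ℕ} (hb : b ∉ A) (hpos : ∀ a ∈ insert b A, 0 < a)
    (n : ℕ) : pA ↑(insert b A) (n + b) = pA ↑A (n + b) + pA ↑(insert b A) n := by
  have hunion : {f | IsRepr ↑(insert b A) {m | 0 < m} (n + b) f} =
      {f | IsRepr ↑A {m | 0 < m} (n + b) f} ∪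
        (· + Finsupp.single b 1) '' {f | IsRepr ↑(insert b A) {m | 0 < m} n f} := by
    ext f
    simp only [Set.mem_ofPred_eq, Set.mem_union, Set.mem_image]
    rw [isRepr_iff_of_apply_eq_zero hb]
    constructor
    · intro h
      by_cases hf : f b = 0
      · exact Or.inl ⟨h, hf⟩
      · have hle : Finsupp.single b 1 ≤ f := by
          rw [Finsupp.single_le_iff]
          omega
        refine Or.inr ⟨f - Finsupp.single b 1, ?_, tsub_add_cancel_of_le hle⟩
        rw [← isRepr_add_single (b := b) (by simp), tsub_add_cancel_of_le hle]
        exact h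
    · rintro (⟨h, -⟩ | ⟨g, hg, rfl⟩)
      · exact h
      · exact (isRepr_add_single (by simp)).mpr hg
  have hdisj : Disjoint {f | IsRepr ↑A {m | 0 < m} (n + b) f}
      ((· + Finsupp.single b 1) '' {f | IsRepr ↑(insert b A) {m | 0 < m} n f}) := by
    rw [Set.disjoint_left]
    rintro _ hf ⟨g, -, rfl⟩
    have := ((isRepr_iff_of_apply_eq_zero hb).mp hf).2
    simp at this
  rw [pA_eq_ncard, hunion, Set.ncard_union_eq hdisj
    (setOf_isRepr_finite A (fun a ha => hpos a (Finset.mem_insert_of_mem ha)) _)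
    ((setOf_isRepr_finite _ hpos _).image _),
    Set.ncard_image_of_injective _ (add_left_injective _)]
  rfl

theorem pA_singleton {a : ℕ} (ha : 0 < a) (n : ℕ) :
    pA ↑({a} : Finset ℕ) n = if a ∣ n then 1 else 0 := by
  rw [← insert_empty_eq a]
  induction n using Nat.strong_induction_on with
  | _ n ih =>
    rcases lt_or_ge n a with h | h
    · rw [pA_insert_of_lt (by simp) h, Finset.coe_empty, pA_empty]
      have : a ∣ n ↔ n = 0 :=
        ⟨fun hd => Nat.eq_zero_of_dvd_of_lt hd h, fun h0 => h0 ▸ dvd_zero a⟩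
      simp only [this]
    · obtain ⟨m, rfl⟩ := Nat.exists_eq_add_of_le' h
      rw [pA_insert_add (by simp) (by simpa using ha), ih m (by omega), Finset.coe_empty, pA_empty,
        if_neg (by omega), zero_add]
      simp

/-! ### Differences of powers -/

theorem pow_sub_pow_le_mul {x y : ℝ} (hx : 0 ≤ x) (hxy : x ≤ y) (k : ℕ) :
    y ^ k - x ^ k ≤ (y - x) * k * y ^ (k - 1) := by
  have h := abs_pow_sub_pow_le y x k
  rwa [abs_of_nonneg (sub_nonneg.mpr (pow_le_pow_left₀ hx hxy k)),
    abs_of_nonneg (sub_nonneg.mpr hxy), abs_of_nonneg hx, abs_of_nonneg (hx.trans hxy),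
    max_eq_left hxy] at h

theorem mul_le_pow_sub_pow {x y : ℝ} (hx : 0 ≤ x) (hxy : x ≤ y) (k : ℕ) :
    (y - x) * k * x ^ (k - 1) ≤ y ^ k - x ^ k := by
  induction k with
  | zero => simp
  | succ k ih =>
    have h1 : (k : ℝ) * x ^ (k - 1) * x = k * x ^ k := by
      cases k with
      | zero => simp
      | succ k => simp only [Nat.add_sub_cancel]; ring
    have h2 : x ^ k ≤ y ^ k := pow_le_pow_left₀ hx hxy k
    have h3 := mul_le_mul_of_nonneg_right ih hx
    have h4 := mul_le_mul_of_nonneg_left h2 (sub_nonneg.mpr hxy)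
    have h5 : (y - x) * k * x ^ (k - 1) * x = (y - x) * (k * x ^ k) := by rw [← h1]; ring
    simp only [Nat.add_sub_cancel]
    push_cast
    rw [h5] at h3
    rw [pow_succ, pow_succ]
    linarith

/-! ### Solving the recurrence asymptotically -/

theorem exists_unique_dvd_add_mul {d b n : ℕ} (hd : 0 < d) (hn : d.gcd b ∣ n) :
    ∃ j < d / d.gcd b, ∀ i < d / d.gcd b, d ∣ n + (i + 1) * b ↔ i = j := by
  have hg : 0 < d.gcd b := Nat.gcd_pos_of_pos_left b hd
  obtain ⟨q, hq⟩ := Nat.gcd_dvd_left d b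
  obtain ⟨c, hc⟩ := Nat.gcd_dvd_right d b
  obtain ⟨m, hm⟩ := hn
  have hdiv : d / d.gcd b = q := Nat.div_eq_of_eq_mul_right hg hq
  have hdivb : b / d.gcd b = c := Nat.div_eq_of_eq_mul_right hg hc
  have hcop : c.Coprime q := by
    have := Nat.coprime_div_gcd_div_gcd hg
    rw [hdiv, hdivb] at this
    exact this.symm
  have hq0 : 0 < q := Nat.pos_of_ne_zero fun h => by simp [h] at hq; omega
  have : NeZero q := ⟨hq0.ne'⟩
  rw [hdiv]
  set g := d.gcd b
  have hiff : ∀ i : ℕ, d ∣ n + (i + 1) * b ↔ q ∣ m + (i + 1) * c := by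
    intro i
    rw [hq, hm, hc, show g * m + (i + 1) * (g * c) = g * (m + (i + 1) * c) by ring]
    exact Nat.mul_dvd_mul_iff_left hg
  have hu : (c : ZMod q) * (c : ZMod q)⁻¹ = 1 := ZMod.coe_mul_inv_eq_one c hcop
  refine ⟨(-(m : ZMod q) * (c : ZMod q)⁻¹ - 1).val, ZMod.val_lt _, fun i hi => ?_⟩
  rw [hiff, ← ZMod.natCast_eq_zero_iff]
  push_cast
  constructor
  · intro h
    have : (i : ZMod q) = -(m : ZMod q) * (c : ZMod q)⁻¹ - 1 := by
      linear_combination (c : ZMod q)⁻¹ * h - ((i : ZMod q) + 1) * hu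
    rw [← this, ZMod.val_natCast, Nat.mod_eq_of_lt hi]
  · intro h
    rw [h, ZMod.natCast_val, ZMod.cast_id]
    linear_combination -(m : ZMod q) * hu

theorem apply_add_mul_eq_sum {F P : ℕ → ℝ} {b : ℕ} (hF : ∀ n, F (n + b) = P (n + b) + F n)
    (n q : ℕ) : F (n + q * b) = ∑ i ∈ Finset.range q, P (n + (i + 1) * b) + F n := by
  induction q with
  | zero => simp
  | succ q ih =>
    rw [Finset.sum_range_succ, show n + (q + 1) * b = n + q * b + b by ring, hF, ih]
    ring

theorem exists_abs_le_of_abs_sub_le {E : ℕ → ℝ} {Q k : ℕ} {D : ℝ} (hQ : 0 < Q)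
    (hE : ∀ n : ℕ, |E (n + Q) - E n| ≤ D * k * ((n : ℝ) + 1) ^ (k - 1)) :
    ∃ K, ∀ n : ℕ, |E n| ≤ K * ((n : ℝ) + 1) ^ k := by
  set K := |D| + ∑ i ∈ Finset.range Q, |E i| with hK
  have hsum : 0 ≤ ∑ i ∈ Finset.range Q, |E i| := Finset.sum_nonneg fun _ _ => abs_nonneg _
  have hK0 : 0 ≤ K := add_nonneg (abs_nonneg _) hsum
  have hDK : D ≤ K := (le_abs_self D).trans (le_add_of_nonneg_right hsum)
  refine ⟨K, fun n => ?_⟩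
  induction n using Nat.strong_induction_on with
  | _ n ih =>
    rcases lt_or_ge n Q with h | h
    · have h1 : |E n| ≤ ∑ i ∈ Finset.range Q, |E i| :=
        Finset.single_le_sum (f := fun i => |E i|) (fun _ _ => abs_nonneg _)
          (Finset.mem_range.mpr h)
      have h2 : (1 : ℝ) ≤ ((n : ℝ) + 1) ^ k := one_le_pow₀ (by simp)
      have h3 : |E n| ≤ K := h1.trans (le_add_of_nonneg_left (abs_nonneg _))
      exact h3.trans (le_mul_of_one_le_right hK0 h2)
    · obtain ⟨m, rfl⟩ := Nat.exists_eq_add_of_le' h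
      have hQ1 : (1 : ℝ) ≤ Q := by exact_mod_cast hQ
      have h1 := mul_le_pow_sub_pow (x := (m : ℝ) + 1) (y := (m : ℝ) + 1 + 1)
        (by positivity) (by linarith) k
      have h2 : ((m : ℝ) + 1 + 1) ^ k ≤ (((m + Q : ℕ) : ℝ) + 1) ^ k := by
        refine pow_le_pow_left₀ (by positivity) ?_ k
        push_cast
        linarith
      have h3 : D * k * ((m : ℝ) + 1) ^ (k - 1) ≤ K * (k * ((m : ℝ) + 1) ^ (k - 1)) := by
        rw [mul_assoc]
        exact mul_le_mul_of_nonneg_right hDK (by positivity)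
      calc |E (m + Q)| = |(E (m + Q) - E m) + E m| := by ring_nf
        _ ≤ |E (m + Q) - E m| + |E m| := abs_add_le _ _
        _ ≤ K * (k * ((m : ℝ) + 1) ^ (k - 1)) + K * ((m : ℝ) + 1) ^ k :=
          add_le_add ((hE m).trans h3) (ih m (by omega))
        _ = K * (k * ((m : ℝ) + 1) ^ (k - 1) + ((m : ℝ) + 1) ^ k) := by ring
        _ ≤ K * (((m + Q : ℕ) : ℝ) + 1) ^ k :=
          mul_le_mul_of_nonneg_left (by linarith) hK0

/-- `P n` is `c * n ^ k` on multiples of `d` and `0` elsewhere, up to an error `O(n ^ (k - 1))`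
which vanishes identically when `k = 0`. -/
def HasPolyGrowth (P : ℕ → ℝ) (d : ℕ) (c : ℝ) (k : ℕ) : Prop :=
  ∃ C, ∀ n : ℕ, |P n - if d ∣ n then c * (n : ℝ) ^ k else 0| ≤ C * k * ((n : ℝ) + 1) ^ (k - 1)

theorem HasPolyGrowth.of_recurrence {P F : ℕ → ℝ} {d b k : ℕ} {c : ℝ} (hd : 0 < d) (hb : 0 < b)
    (hc : 0 ≤ c) (hP : HasPolyGrowth P d c k) (hF : ∀ n, F (n + b) = P (n + b) + F n) :
    HasPolyGrowth F (d.gcd b) (c * d.gcd b / (d * b * (k + 1))) (k + 1) := by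
  obtain ⟨C, hC⟩ := hP
  set g := d.gcd b with hg
  have hg0 : 0 < g := Nat.gcd_pos_of_pos_left b hd
  set q := d / g with hq
  have hgq : g * q = d := Nat.mul_div_cancel' (Nat.gcd_dvd_left d b)
  have hq0 : 0 < q := Nat.pos_of_mul_pos_left (hgq ▸ hd)
  set Q := q * b with hQ
  have hQ0 : 0 < Q := Nat.mul_pos hq0 hb
  set c' := c * g / (d * b * (k + 1)) with hc'
  have hc'0 : 0 ≤ c' := by positivity
  have hcc' : c' * (Q * (k + 1)) = c := by
    rw [hc', hQ, ← hgq]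
    push_cast
    field_simp
  have hgQ : g ∣ Q := (Nat.gcd_dvd_right d b).mul_left q
  set E : ℕ → ℝ := fun n => F n - if g ∣ n then c' * (n : ℝ) ^ (k + 1) else 0 with hE
  set e : ℕ → ℝ := fun n => P n - if d ∣ n then c * (n : ℝ) ^ k else 0 with he
  have hbase : ∀ n : ℕ, ((n : ℝ) + Q + 1) ^ (k - 1) ≤
      ((Q : ℝ) + 1) ^ (k - 1) * ((n : ℝ) + 1) ^ (k - 1) := by
    intro n
    rw [← mul_pow]
    refine pow_le_pow_left₀ (by positivity) ?_ _
    have : (0 : ℝ) ≤ Q * n := by positivity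
    nlinarith
  have herr : ∀ n : ℕ, |∑ i ∈ Finset.range q, e (n + (i + 1) * b)| ≤
      q * (|C| * k * (((Q : ℝ) + 1) ^ (k - 1) * ((n : ℝ) + 1) ^ (k - 1))) := by
    intro n
    refine (Finset.abs_sum_le_sum_abs _ _).trans ?_
    rw [← nsmul_eq_mul]
    conv_rhs => rw [← Finset.card_range q]
    refine Finset.sum_le_card_nsmul _ _ _ fun i hi => (hC _).trans ?_
    have hi' : (i + 1) * b ≤ Q := Nat.mul_le_mul_right b (Finset.mem_range.mp hi)
    have h1 : ((n + (i + 1) * b : ℕ) : ℝ) + 1 ≤ (n : ℝ) + Q + 1 := by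
      have : ((n + (i + 1) * b : ℕ) : ℝ) ≤ ((n + Q : ℕ) : ℝ) := by exact_mod_cast by omega
      push_cast at this ⊢
      linarith
    refine mul_le_mul (mul_le_mul_of_nonneg_right (le_abs_self C) (by positivity))
      ((pow_le_pow_left₀ (by positivity) h1 _).trans (hbase n)) (by positivity) (by positivity)
  have hmain : ∀ n : ℕ, |∑ i ∈ Finset.range q,
      (if d ∣ n + (i + 1) * b then c * ((n + (i + 1) * b : ℕ) : ℝ) ^ k else 0) -
      (if g ∣ n then c' * (((n + Q : ℕ) : ℝ) ^ (k + 1) - (n : ℝ) ^ (k + 1)) else 0)| ≤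
      c * (Q * k * (((Q : ℝ) + 1) ^ (k - 1) * ((n : ℝ) + 1) ^ (k - 1))) := by
    intro n
    by_cases hgn : g ∣ n
    · obtain ⟨j, hj, hiff⟩ := exists_unique_dvd_add_mul hd hgn
      rw [if_pos hgn, Finset.sum_eq_single j]
      rotate_left
      · intro i hi hij
        rw [if_neg]
        rwa [hiff i (Finset.mem_range.mp hi)]
      · intro h
        exact absurd (Finset.mem_range.mpr hj) h
      rw [if_pos ((hiff j hj).mpr rfl)]
      have hj' : (j + 1) * b ≤ Q := Nat.mul_le_mul_right b hj
      set m := n + (j + 1) * b with hm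
      have hnm : (n : ℝ) ≤ m := by exact_mod_cast by omega
      have hmQ : (m : ℝ) ≤ (n : ℝ) + Q := by exact_mod_cast by omega
      have hn0 : (0 : ℝ) ≤ n := Nat.cast_nonneg n
      have hQr : (0 : ℝ) ≤ Q := Nat.cast_nonneg Q
      have h1 := pow_le_pow_left₀ hn0 hnm k
      have h2 := pow_le_pow_left₀ (hn0.trans hnm) hmQ k
      have h3 := mul_le_pow_sub_pow hn0 (hnm.trans hmQ) (k + 1)
      have h4 := pow_sub_pow_le_mul hn0 (hnm.trans hmQ) (k + 1)
      have h5 := pow_sub_pow_le_mul hn0 (hnm.trans hmQ) k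
      simp only [Nat.add_sub_cancel, add_sub_cancel_left, Nat.cast_add, Nat.cast_one] at h3 h4 h5
      have h6 : ((n : ℝ) + Q) ^ (k - 1) ≤ ((n : ℝ) + Q + 1) ^ (k - 1) :=
        pow_le_pow_left₀ (by positivity) (by linarith) _
      have h7 := mul_le_mul_of_nonneg_left (h6.trans (hbase n))
        (show (0 : ℝ) ≤ Q * k by positivity)
      have h8 := mul_le_mul_of_nonneg_left (h5.trans h7) hc
      have h9 := mul_le_mul_of_nonneg_left h1 hc
      have h10 := mul_le_mul_of_nonneg_left h2 hc
      have h11 := mul_le_mul_of_nonneg_left h3 hc'0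
      have h12 := mul_le_mul_of_nonneg_left h4 hc'0
      rw [← mul_assoc, hcc'] at h11 h12
      push_cast
      rw [abs_le]
      constructor <;> linarith
    · have hz : ∀ i ∈ Finset.range q,
          (if d ∣ n + (i + 1) * b then c * ((n + (i + 1) * b : ℕ) : ℝ) ^ k else 0) = 0 := by
        intro i _
        rw [if_neg]
        intro h
        refine hgn ((Nat.dvd_add_left ((Nat.gcd_dvd_right d b).mul_left (i + 1))).mp ?_)
        exact (Nat.gcd_dvd_left d b).trans h
      rw [Finset.sum_eq_zero hz, if_neg hgn, sub_zero, abs_zero]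
      positivity
  obtain ⟨K, hK⟩ := exists_abs_le_of_abs_sub_le (E := E) (k := k)
    (D := (q * |C| + c * Q) * ((Q : ℝ) + 1) ^ (k - 1)) hQ0 fun n => by
    have hdiff : E (n + Q) - E n = ∑ i ∈ Finset.range q, e (n + (i + 1) * b) +
        (∑ i ∈ Finset.range q,
          (if d ∣ n + (i + 1) * b then c * ((n + (i + 1) * b : ℕ) : ℝ) ^ k else 0) -
          (if g ∣ n then c' * (((n + Q : ℕ) : ℝ) ^ (k + 1) - (n : ℝ) ^ (k + 1)) else 0)) := by
      have hdvd : g ∣ n + Q ↔ g ∣ n := Nat.dvd_add_left hgQ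
      simp only [hE, he, Finset.sum_sub_distrib, hdvd]
      rw [hQ, apply_add_mul_eq_sum hF]
      split_ifs <;> ring
    rw [hdiff]
    refine (abs_add_le _ _).trans ((add_le_add (herr n) (hmain n)).trans_eq ?_)
    ring
  refine ⟨|K|, fun n => (hK n).trans ?_⟩
  have h1 : (1 : ℝ) ≤ ((k + 1 : ℕ) : ℝ) := by simp
  rw [Nat.add_sub_cancel]
  refine mul_le_mul_of_nonneg_right ?_ (by positivity)
  exact (le_abs_self K).trans (le_mul_of_one_le_right (abs_nonneg K) h1)

theorem hasPolyGrowth_pA {A : Finset ℕ} (hA : A.Nonempty) (hpos : ∀ a ∈ A, 0 < a) :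
    HasPolyGrowth (fun n => (pA ↑A n : ℝ)) (A.gcd id)
      ((A.gcd id : ℕ) / ((A.card - 1).factorial * ∏ a ∈ A, (a : ℝ))) (A.card - 1) := by
  induction hA using Finset.Nonempty.cons_induction with
  | singleton a =>
    have ha : 0 < a := hpos a (Finset.mem_singleton_self a)
    have ha' : (a : ℝ) ≠ 0 := by positivity
    refine ⟨0, fun n => ?_⟩
    simp only [pA_singleton ha]
    by_cases h : a ∣ n <;> simp [h, ha']
  | cons b s hb hs ih =>
    rw [Finset.cons_eq_insert] at hpos ⊢
    have hposs : ∀ a ∈ s, 0 < a := fun a ha => hpos a (Finset.mem_insert_of_mem ha)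
    have hb0 : 0 < b := hpos b (Finset.mem_insert_self b s)
    have hd : 0 < s.gcd id := by
      obtain ⟨a, ha⟩ := hs
      refine Nat.pos_of_ne_zero fun h => ?_
      exact (hposs a ha).ne' (Finset.gcd_eq_zero_iff.mp h a ha)
    have hprod : 0 < ∏ a ∈ s, (a : ℝ) :=
      Finset.prod_pos fun a ha => by exact_mod_cast hposs a ha
    have key := (ih hposs).of_recurrence (F := fun n => (pA ↑(insert b s) n : ℝ)) hd hb0
      (by positivity) (fun n => by exact_mod_cast pA_insert_add hb hpos n)
    obtain ⟨k, hk⟩ : ∃ k, s.card = k + 1 := Nat.exists_eq_succ_of_ne_zero hs.card_pos.ne'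
    have hgcd : (insert b s).gcd id = (s.gcd id).gcd b := by
      rw [Finset.gcd_insert, id, gcd_comm]
      rfl
    rw [hgcd, Finset.card_insert_of_notMem hb, Finset.prod_insert hb]
    simp only [hk, Nat.add_sub_cancel] at key ⊢
    convert key using 1
    have hdr : ((s.gcd id : ℕ) : ℝ) ≠ 0 := by positivity
    rw [Nat.factorial_succ]
    push_cast
    field_simp

theorem HasPolyGrowth.isEquivalent {P : ℕ → ℝ} {c : ℝ} {k : ℕ} (hc : c ≠ 0)
    (hP : HasPolyGrowth P 1 c k) :
    Asymptotics.IsEquivalent atTop P (fun n : ℕ => c * (n : ℝ) ^ k) := by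
  obtain ⟨C, hC⟩ := hP
  simp only [one_dvd, if_true] at hC
  refine Asymptotics.IsLittleO.const_mul_right hc ?_
  cases k with
  | zero =>
    refine Asymptotics.IsLittleO.congr_left (Asymptotics.isLittleO_zero _ _) fun n => ?_
    have := hC n
    simp only [Nat.cast_zero, mul_zero, zero_mul] at this
    exact (abs_nonpos_iff.mp this).symm
  | succ k =>
    have hlo : (fun n : ℕ => (n : ℝ) ^ k) =o[atTop] (fun n : ℕ => (n : ℝ) ^ (k + 1)) :=
      (Asymptotics.isLittleO_pow_pow_atTop_of_lt (Nat.lt_succ_self k)).comp_tendsto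
        tendsto_natCast_atTop_atTop
    refine Asymptotics.IsBigO.trans_isLittleO ?_ hlo
    refine Asymptotics.IsBigO.of_bound (|C| * (k + 1) * 2 ^ k) ?_
    filter_upwards [eventually_ge_atTop 1] with n hn
    have hn' : (1 : ℝ) ≤ n := by exact_mod_cast hn
    rw [Real.norm_eq_abs, Real.norm_eq_abs, abs_of_nonneg (by positivity : (0 : ℝ) ≤ (n : ℝ) ^ k)]
    refine (hC n).trans ?_
    rw [Nat.add_sub_cancel, mul_assoc (|C| * (k + 1) : ℝ), ← mul_pow]
    push_cast
    exact mul_le_mul (mul_le_mul_of_nonneg_right (le_abs_self C) (by positivity))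
      (pow_le_pow_left₀ (by positivity) (by linarith) k) (by positivity) (by positivity)

theorem stmt1 (A : Finset ℕ) (k : ℕ) (hk : 0 < k) (hcard : A.card = k)
    (hpos : ∀ a ∈ A, 0 < a) (hgcd : A.gcd id = 1) :
    Asymptotics.IsEquivalent atTop (fun n : ℕ => (pA ↑A n : ℝ))
      (fun n : ℕ => (n : ℝ) ^ (k - 1) / ((k - 1).factorial * ∏ a ∈ A, (a : ℝ))) := by
  have hprod : 0 < ∏ a ∈ A, (a : ℝ) := Finset.prod_pos fun a ha => by exact_mod_cast hpos a ha
  have h := hasPolyGrowth_pA (Finset.card_pos.mp (hcard ▸ hk)) hpos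
  rw [hgcd, hcard, Nat.cast_one] at h
  refine (h.isEquivalent (by positivity)).congr_right (Eventually.of_forall fun n => ?_)
  ring
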